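/- arXiv:1406.2510 — 13 statements merged into one kernel-verified Lean document; each statement's English description precedes it below -/
import Mathlib

section
/- For every element y of a skew lattice S, the sets y∧S = {y∧u : u ∈ S} and S∧y = {u∧y : u ∈ S} are closed under both operations ∧ and ∨, i.e. they are sub-skew-lattices of S. -/
/-- A skew lattice: a set with two idempotent associative operations
satisfying the absorption laws. -/
class SkewLattice (S : Type*) where
  meet : S → S → S
  join : S → S → S
  meet_assoc : ∀ x y z : S, meet (meet x y) z = meet x (meet y z)
  join_assoc : ∀ x y z : S, join (join x y) z = join x (join y z)
  meet_idem : ∀ x : S, meet x x = x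
  join_idem : ∀ x : S, join x x = x
  absorb₁ : ∀ x y : S, meet x (join x y) = x
  absorb₂ : ∀ x y : S, meet (join y x) x = x
  absorb₃ : ∀ x y : S, join x (meet x y) = x
  absorb₄ : ∀ x y : S, join (meet y x) x = x

namespace SkewLattice

variable {S : Type*} [SkewLattice S]

local infixl:70 " ∧' " => SkewLattice.meet
local infixl:65 " ∨' " => SkewLattice.join

/-- The flat preorder `≤_L`: `x ≤_L y` iff `x ∧ y = x`. -/
def leqL (x y : S) : Prop := x ∧' y = x

/-- The flat preorder `≤_R`: `x ≤_R y` iff `y ∧ x = x`. -/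
def leqR (x y : S) : Prop := y ∧' x = x

/-- Green's relation `R`. -/
def relR (x y : S) : Prop := x ∧' y = y ∧ y ∧' x = x

/-- Green's relation `L`. -/
def relL (x y : S) : Prop := x ∧' y = x ∧ y ∧' x = y

/-- Green's relation `D`. -/
def relD (x y : S) : Prop := x ∧' y ∧' x = x ∧ y ∧' x ∧' y = y

/-- The natural preorder `⪯`. -/
def preceq (x y : S) : Prop := x ∧' y ∧' x = x

/-- A `D`-class: an equivalence class of Green's relation `D`. -/
def IsDClass (A : Set S) : Prop := ∃ a : S, A = {x | relD x a}

/-- `A > B` for `D`-classes: `A` and `B` are `D`-classes with every element of `B`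
strictly below every element of `A` in the natural preorder. -/
def classGT (A B : Set S) : Prop :=
  IsDClass A ∧ IsDClass B ∧ ∀ a ∈ A, ∀ b ∈ B, preceq b a ∧ ¬ preceq a b

/-- A skew diamond `{J > A, B > M}`: two incomparable `D`-classes `A`, `B`
together with the `D`-class `M` of `a ∧ b ∧ a` and the `D`-class `J` of
`a ∨ b ∨ a` for some `a ∈ A`, `b ∈ B`. -/
def IsSkewDiamond (J A B M : Set S) : Prop :=
  IsDClass J ∧ IsDClass A ∧ IsDClass B ∧ IsDClass M ∧
  (∀ a ∈ A, ∀ b ∈ B, ¬ preceq a b ∧ ¬ preceq b a) ∧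
  ∃ a ∈ A, ∃ b ∈ B, (a ∧' b ∧' a) ∈ M ∧ (a ∨' b ∨' a) ∈ J

/-- for every `y`, the sets `y∧S` and `S∧y` are closed under `∧` and `∨`. -/
theorem ideal_subalgebra (y : S) :
    (∀ a ∈ {z : S | ∃ u : S, z = y ∧' u}, ∀ b ∈ {z : S | ∃ u : S, z = y ∧' u},
      (a ∧' b) ∈ {z : S | ∃ u : S, z = y ∧' u} ∧
      (a ∨' b) ∈ {z : S | ∃ u : S, z = y ∧' u}) ∧
    (∀ a ∈ {z : S | ∃ u : S, z = u ∧' y}, ∀ b ∈ {z : S | ∃ u : S, z = u ∧' y},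
      (a ∧' b) ∈ {z : S | ∃ u : S, z = u ∧' y} ∧
      (a ∨' b) ∈ {z : S | ∃ u : S, z = u ∧' y}) := by
  refine ⟨?_, ?_⟩
  · rintro a ⟨u, rfl⟩ b ⟨v, rfl⟩
    refine ⟨⟨u ∧' (y ∧' v), meet_assoc _ _ _⟩, ⟨(y ∧' u) ∨' (y ∧' v), ?_⟩⟩
    have h : y ∨' ((y ∧' u) ∨' (y ∧' v)) = y := by
      rw [← join_assoc, absorb₃, absorb₃]
    have h2 := absorb₂ ((y ∧' u) ∨' (y ∧' v)) y
    rw [h] at h2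
    exact h2.symm
  · rintro a ⟨u, rfl⟩ b ⟨v, rfl⟩
    refine ⟨⟨(u ∧' y) ∧' v, (meet_assoc _ _ _).symm⟩, ⟨(u ∧' y) ∨' (v ∧' y), ?_⟩⟩
    have h : ((u ∧' y) ∨' (v ∧' y)) ∨' y = y := by
      rw [join_assoc, absorb₄, absorb₄]
    have h2 := absorb₁ ((u ∧' y) ∨' (v ∧' y)) y
    rw [h] at h2
    exact h2.symm

end SkewLattice
end

section
/- Let S be a skew lattice and a ∈ S. The following statements are equivalent: (i) a is right-central, i.e. for all u ∈ S, a R u implies u = a; (ii) for all b ∈ S, b∨a = a∨b∨a; (iii) for all b ∈ S, a∨b = b∨a∨b; (iv) for all b ∈ S, a∧b = a∧b∧a; (v) for all b ∈ S, b∧a = b∧a∧b. -/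
namespace SkewLattice

variable {S : Type*} [SkewLattice S]

local infixl:70 " ∧' " => SkewLattice.meet
local infixl:65 " ∨' " => SkewLattice.join

/-- characterizations of right-central elements. -/
theorem rightCentral_tfae (a : S) :
    List.TFAE [
      ∀ u : S, relR a u → u = a,
      ∀ b : S, b ∨' a = a ∨' b ∨' a,
      ∀ b : S, a ∨' b = b ∨' a ∨' b,
      ∀ b : S, a ∧' b = a ∧' b ∧' a,
      ∀ b : S, b ∧' a = b ∧' a ∧' b ] := by
  have i_iv : (∀ u : S, relR a u → u = a) → ∀ b : S, a ∧' b = a ∧' b ∧' a := by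
    intro h b
    have hw : a ∧' b ∨' a = a := by
      apply h
      have h1 : a ∨' (a ∧' b ∨' a) = a := by
        rw [← join_assoc, absorb₃, join_idem]
      have h2 : (a ∧' b ∨' a) ∨' a = a ∧' b ∨' a := by
        rw [join_assoc, join_idem]
      constructor
      · have := absorb₂ (a ∧' b ∨' a) a
        rwa [h1] at this
      · exact absorb₂ a (a ∧' b)
    have := absorb₁ (a ∧' b) a
    rw [hw] at this
    exact this.symm
  have i_ii : (∀ u : S, relR a u → u = a) → ∀ b : S, b ∨' a = a ∨' b ∨' a := by
    intro h b
    have hw : a ∧' (b ∨' a) = a := by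
      apply h
      constructor
      · rw [← meet_assoc, meet_idem]
      · rw [meet_assoc, absorb₂, meet_idem]
    have := absorb₄ (b ∨' a) a
    rw [hw] at this
    rw [join_assoc]
    exact this.symm
  have key : ∀ u : S, relR a u → a ∨' u = a ∧ u ∨' a = u := by
    rintro u ⟨h1, h2⟩
    have h3 := absorb₃ a u
    have h4 := absorb₃ u a
    rw [h1] at h3
    rw [h2] at h4
    exact ⟨h3, h4⟩
  tfae_have 1 → 2 := i_ii
  tfae_have 2 → 3 := by
    intro h b
    rw [h b, join_assoc, join_assoc, ← join_assoc b a b, ← join_assoc a (b ∨' a) b,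
      ← join_assoc a b a, join_assoc (a ∨' b) a b, join_idem]
  tfae_have 3 → 1 := by
    intro h u hu
    obtain ⟨h1, h2⟩ := key u hu
    have := h u
    rw [h1, h2, join_idem] at this
    exact this.symm
  tfae_have 1 → 4 := i_iv
  tfae_have 4 → 5 := by
    intro h b
    rw [meet_assoc, h b, ← meet_assoc, ← meet_assoc, meet_assoc, meet_idem]
  tfae_have 5 → 1 := by
    rintro h u ⟨h1, h2⟩
    have := h u
    rw [h2, h1] at this
    exact this.symm
  tfae_finish

end SkewLattice
end

section
/- Let S be a skew lattice. If x and y are right-central elements of S, then x∧y and x∨y are right-central; moreover, any two right-central elements x, y satisfy x∧y∧x = x∧y and x∨y∨x = y∨x (so the right-center is a left-handed sub-skew-lattice of S). Furthermore, an element of S is central if and only if it is both left-central and right-central. -/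
namespace SkewLattice

variable {S : Type*} [SkewLattice S]

local infixl:70 " ∧' " => SkewLattice.meet
local infixl:65 " ∨' " => SkewLattice.join

/-- An element is right-central if its `R`-class is trivial. -/
def rightCentral (a : S) : Prop := ∀ u : S, relR a u → u = a

/-- An element is left-central if its `L`-class is trivial. -/
def leftCentral (a : S) : Prop := ∀ u : S, relL a u → u = a

/-- An element is central if its `D`-class is trivial. -/
def central (a : S) : Prop := ∀ u : S, relD a u → u = a

theorem rc_meet {x : S} (hx : rightCentral x) {u : S} (h : x ∧' u = u) : u ∧' x = u := by
  have h1 : x ∨' u = x := by rw [← h]; exact absorb₃ x u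
  have h2 : u ∨' x = x := by
    apply hx
    refine ⟨?_, absorb₂ x u⟩
    have h3 : x ∨' (u ∨' x) = x := by rw [← join_assoc, h1, join_idem]
    have h4 := absorb₂ (u ∨' x) x
    rwa [h3] at h4
  have h5 := absorb₁ u x
  rwa [h2] at h5

theorem rc_join {x : S} (hx : rightCentral x) {u : S} (h : u ∨' x = u) : x ∨' u = u := by
  have h1 : u ∧' x = x := by
    have h4 := absorb₂ x u
    rwa [h] at h4
  have h2 : x ∧' u = x := by
    apply hx
    refine ⟨by rw [← meet_assoc, meet_idem], by rw [meet_assoc, h1, meet_idem]⟩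
  have h5 := absorb₄ u x
  rwa [h2] at h5

theorem relR_join {x u : S} (h : relR x u) : x ∨' u = x ∧ u ∨' x = u := by
  obtain ⟨h1, h2⟩ := h
  have h3 := absorb₃ x u
  have h4 := absorb₃ u x
  rw [h1] at h3
  rw [h2] at h4
  exact ⟨h3, h4⟩

/-- the right-center is closed under both operations, is left-handed,
and the center is the intersection of the left- and right-centers. -/
theorem rightCenter_props :
    (∀ x y : S, rightCentral x → rightCentral y →
      rightCentral (x ∧' y) ∧ rightCentral (x ∨' y)) ∧
    (∀ x y : S, rightCentral x → rightCentral y →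
      x ∧' y ∧' x = x ∧' y ∧ x ∨' y ∨' x = y ∨' x) ∧
    (∀ a : S, central a ↔ leftCentral a ∧ rightCentral a) := by
  have M : ∀ x y : S, rightCentral x → x ∧' y ∧' x = x ∧' y := fun x y hx =>
    rc_meet hx (by rw [← meet_assoc, meet_idem])
  have J : ∀ x y : S, rightCentral x → x ∨' y ∨' x = y ∨' x := fun x y hx => by
    rw [join_assoc]
    exact rc_join hx (by rw [join_assoc, join_idem])
  refine ⟨fun x y hx hy => ⟨?_, ?_⟩, fun x y hx hy => ⟨M x y hx, J x y hx⟩, fun a => ⟨?_, ?_⟩⟩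
  · rintro u ⟨h1, h2⟩
    have h3 : x ∧' u = u := by rw [← h1, ← meet_assoc, ← meet_assoc, meet_idem]
    have h4 : u ∧' x = u := rc_meet hx h3
    have h5 : u ∧' y = x ∧' y := by rw [← h2, ← meet_assoc, h4]
    have h6 : u ∧' y = u := by
      calc u ∧' y = x ∧' y ∧' u ∧' y := by rw [h1]
        _ = x ∧' (y ∧' u ∧' y) := by simp only [meet_assoc]
        _ = u := by rw [M y u hy, ← meet_assoc, h1]
    rw [← h6, h5]
  · intro u h
    obtain ⟨h1, h2⟩ := relR_join h
    have h3 : u ∨' y = u := by rw [← h2, join_assoc, join_assoc, join_idem]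
    have h4 : y ∨' u = u := rc_join hy h3
    have h5 : x ∨' u = x ∨' y := by rw [← h1, join_assoc, h4]
    have h6 : x ∨' u = u := by
      calc x ∨' u = x ∨' (u ∨' (x ∨' y)) := by rw [h2]
        _ = x ∨' u ∨' x ∨' y := by simp only [join_assoc]
        _ = u := by rw [J x u hx, join_assoc, h2]
    rw [← h6, h5]
  · intro h
    refine ⟨fun u hu => h u ?_, fun u hu => h u ?_⟩
    · obtain ⟨h1, h2⟩ := hu
      exact ⟨by rw [h1, meet_idem], by rw [h2, meet_idem]⟩
    · obtain ⟨h1, h2⟩ := hu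
      exact ⟨by rw [h1, h2], by rw [h2, h1]⟩
  · rintro ⟨hl, hr⟩ u ⟨h1, h2⟩
    have h3 : a ∧' u = a := hr _ ⟨by rw [← meet_assoc, meet_idem], h1⟩
    have h4 : u ∧' a = a := hl _ ⟨by rw [← meet_assoc, h1], by rw [meet_assoc, meet_idem]⟩
    rw [← h2, h4, h3]

end SkewLattice
end

section
/- Let S be a skew lattice. Then: (i) S satisfies the identity x∨y∨x = (y∧x)∨y∨x (for all x,y) if and only if S satisfies the identity x∨y∨x = (x∧y∧x)∨y∨x; (ii) S satisfies x∨y∨x = x∨y∨(x∧y) if and only if S satisfies x∨y∨x = x∨y∨(x∧y∧x); (iii) S satisfies x∧y∧x = x∧y∧(x∨y) if and only if S satisfies x∧y∧x = x∧y∧(x∨y∨x); (iv) S satisfies x∧y∧x = (y∨x)∧y∧x if and only if S satisfies x∧y∧x = (x∨y∨x)∧y∧x. -/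
namespace SkewLattice

variable {S : Type*} [SkewLattice S]

local infixl:70 " ∧' " => SkewLattice.meet
local infixl:65 " ∨' " => SkewLattice.join

/-- Left-right mirror. -/
@[reducible] def mir (I : SkewLattice S) : SkewLattice S where
  meet x y := I.meet y x
  join x y := I.join y x
  meet_assoc x y z := (I.meet_assoc z y x).symm
  join_assoc x y z := (I.join_assoc z y x).symm
  meet_idem := I.meet_idem
  join_idem := I.join_idem
  absorb₁ := I.absorb₂
  absorb₂ := I.absorb₁
  absorb₃ := I.absorb₄
  absorb₄ := I.absorb₃

/-- Order dual. -/
@[reducible] def dul (I : SkewLattice S) : SkewLattice S where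
  meet := I.join
  join := I.meet
  meet_assoc := I.join_assoc
  join_assoc := I.meet_assoc
  meet_idem := I.join_idem
  join_idem := I.meet_idem
  absorb₁ := I.absorb₃
  absorb₂ := I.absorb₄
  absorb₃ := I.absorb₁
  absorb₄ := I.absorb₂

theorem m_idem2 (x z : S) : x ∧' (x ∧' z) = x ∧' z := by
  rw [← meet_assoc, meet_idem]

theorem m_pair (x y : S) : x ∧' (y ∧' (x ∧' y)) = x ∧' y := by
  rw [← meet_assoc, meet_idem]

theorem m_pair2 (x y z : S) : x ∧' (y ∧' (x ∧' (y ∧' z))) = x ∧' (y ∧' z) := by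
  have := congrArg (· ∧' z) (m_pair x y)
  simpa only [meet_assoc] using this

/-- If `a` factors through `b` then `a b a = a`. -/
theorem fac (a b s t : S) (h : a = s ∧' (b ∧' t)) : a ∧' (b ∧' a) = a := by
  have h1 : a ∧' (b ∧' t) = a := by
    conv_lhs => rw [h]
    rw [meet_assoc, meet_idem, ← h]
  have h2 : a ∧' (b ∧' (t ∧' a)) = a := by
    have := congrArg (· ∧' a) h1
    simpa only [meet_assoc, meet_idem] using this
  calc a ∧' (b ∧' a) = a ∧' (b ∧' (a ∧' (b ∧' (t ∧' a)))) := by rw [h2]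
    _ = a ∧' (b ∧' (t ∧' a)) := m_pair2 _ _ _
    _ = a := h2

/-- `b ≼ u` in the meet sense gives the join sense. -/
theorem pre (y v : S) (h : v ∧' (y ∧' v) = v) : y ∨' (v ∨' y) = y := by
  have h1 : v ∨' (y ∧' v) = y ∧' v := by
    have := absorb₄ (y ∧' v) v
    rwa [h] at this
  have h2 : y ∨' (v ∨' (y ∧' v)) = y := by rw [h1, absorb₃]
  calc y ∨' (v ∨' y) = y ∨' (v ∨' (y ∨' (v ∨' (y ∧' v)))) := by rw [h2]
    _ = y ∨' (v ∨' (y ∧' v)) := @m_pair2 S (dul _) _ _ _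
    _ = y := h2

theorem key (b u v : S) (h : b ∧' (u ∧' b) = b) (h1 : u ∧' v = u) (h2 : v ∧' u = v) :
    b ∧' u = b ∧' v := by
  have hp : u ∨' (b ∨' u) = u := pre u b h
  have hau : (b ∨' u) ∧' u = u := absorb₂ _ _
  have hba : b ∧' (b ∨' u) = b := absorb₁ _ _
  have hua : u ∧' (b ∨' u) = b ∨' u := by
    have := absorb₂ (b ∨' u) u
    rwa [hp] at this
  generalize b ∨' u = a at *
  have hava : a ∧' (v ∧' a) = a := fac a v u a (by rw [← meet_assoc, h1, hua])
  have hav : a ∧' v = u := by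
    have := congrArg (· ∧' u) hava
    simpa only [meet_assoc, hau, h2] using this
  rw [← hav, ← meet_assoc, hba]

theorem cl (x y : S) : x ∧' ((y ∨' x) ∧' y) = x ∧' y := by
  have aux : ∀ (I : SkewLattice S) (x u v : S), I.meet u v = u → I.meet v u = v →
      I.meet x u = I.meet (I.meet x u) (I.meet x v) := by
    intro I x u v h1 h2
    have := key (x ∧' (u ∧' x)) u v (by simp only [meet_assoc, m_idem2, m_pair, m_pair2]) h1 h2
    simp only [meet_assoc, m_pair] at this ⊢
    exact this
  have hj1 : (y ∨' x) ∧' x = x := absorb₂ _ _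
  have hj2 : y ∧' (y ∨' x) = y := absorb₁ _ _
  generalize y ∨' x = j at *
  have e1 := aux inferInstance x y (j ∧' y) (by rw [← meet_assoc, hj2, meet_idem])
    (by rw [meet_assoc, meet_idem])
  have e2 := aux (mir inferInstance) y (x ∧' j) x
    (show x ∧' (x ∧' j) = x ∧' j from m_idem2 _ _)
    (show (x ∧' j) ∧' x = x by rw [meet_assoc, hj1, meet_idem])
  change (x ∧' j) ∧' y = (x ∧' y) ∧' ((x ∧' j) ∧' y) at e2
  rw [meet_assoc x j y] at e2
  rw [e1, ← e2]

theorem cl' (x y : S) : x ∨' ((y ∧' x) ∨' y) = x ∨' y := @cl S (dul _) x y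

/-- The absorption step. -/
theorem absL (p v : S) (h1 : v ∧' p = v) (h2 : p ∧' (v ∧' p) = p) : p ∨' v = v := by
  rw [h1] at h2
  conv_lhs => rw [← h2]
  exact absorb₄ _ _

theorem part1 :
    (∀ x y : S, x ∨' y ∨' x = (y ∧' x) ∨' y ∨' x) ↔
      (∀ x y : S, x ∨' y ∨' x = (x ∧' y ∧' x) ∨' y ∨' x) := by
  constructor
  · intro A x y
    have hA := A x ((x ∧' y ∧' x) ∨' y)
    have hp : ((x ∧' y ∧' x ∨' y) ∧' x) ∨' (x ∧' y ∧' x) = x ∧' y ∧' x := by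
      have hvw : (x ∧' y ∧' x) ∧' (x ∧' y ∧' x ∨' y) = x ∧' y ∧' x := absorb₁ _ _
      have hyw : y ∨' (x ∧' y ∧' x ∨' y) = y :=
        pre y (x ∧' y ∧' x) (by simp only [meet_assoc, m_idem2, m_pair, m_pair2])
      have hyw' : y ∧' (x ∧' y ∧' x ∨' y) = (x ∧' y ∧' x ∨' y) := by
        have := absorb₂ (x ∧' y ∧' x ∨' y) y
        rwa [hyw] at this
      generalize x ∧' y ∧' x ∨' y = w at *
      apply absL
      · rw [← meet_assoc, hvw, meet_assoc, meet_idem]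
      · apply fac _ _ w (y ∧' (w ∧' x))
        simp only [meet_assoc, m_idem2, m_pair, m_pair2]
        rw [← meet_assoc y w x, hyw', m_pair]
    have hx : x ∨' (x ∧' y ∧' x) = x := by rw [meet_assoc, absorb₃]
    have e : x ∨' (x ∧' y ∧' x ∨' y) = x ∨' y := by rw [← join_assoc, hx]
    rw [e, ← join_assoc _ (x ∧' y ∧' x) y, hp] at hA
    exact hA
  · intro B x y
    have hB := B x ((y ∧' x) ∨' y)
    have hp : (x ∧' (y ∧' x ∨' y) ∧' x) ∨' (y ∧' x) = y ∧' x := by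
      have huw : (y ∧' x) ∧' (y ∧' x ∨' y) = y ∧' x := absorb₁ _ _
      have hyw : y ∨' (y ∧' x ∨' y) = y :=
        pre y (y ∧' x) (by simp only [meet_assoc, m_idem2, m_pair, m_pair2])
      have hyw' : y ∧' (y ∧' x ∨' y) = (y ∧' x ∨' y) := by
        have := absorb₂ (y ∧' x ∨' y) y
        rwa [hyw] at this
      generalize y ∧' x ∨' y = w at *
      apply absL
      · have := congrArg (· ∧' x) huw
        simpa only [meet_assoc, m_idem2, meet_idem] using this
      · apply fac _ _ (x ∧' w ∧' x) (y ∧' (w ∧' x))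
        simp only [meet_assoc, m_idem2, m_pair, m_pair2]
        rw [← meet_assoc y w x, hyw', m_pair2]
    rw [cl', ← join_assoc _ (y ∧' x) y, hp] at hB
    exact hB

/-- equivalent identities for right/left upper/lower symmetry. -/
theorem symmetry_identities :
    ((∀ x y : S, x ∨' y ∨' x = (y ∧' x) ∨' y ∨' x) ↔
      (∀ x y : S, x ∨' y ∨' x = (x ∧' y ∧' x) ∨' y ∨' x)) ∧
    ((∀ x y : S, x ∨' y ∨' x = x ∨' y ∨' (x ∧' y)) ↔
      (∀ x y : S, x ∨' y ∨' x = x ∨' y ∨' (x ∧' y ∧' x))) ∧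
    ((∀ x y : S, x ∧' y ∧' x = x ∧' y ∧' (x ∨' y)) ↔
      (∀ x y : S, x ∧' y ∧' x = x ∧' y ∧' (x ∨' y ∨' x))) ∧
    ((∀ x y : S, x ∧' y ∧' x = (y ∨' x) ∧' y ∧' x) ↔
      (∀ x y : S, x ∧' y ∧' x = (x ∨' y ∨' x) ∧' y ∧' x)) := by
  refine ⟨part1, ?_, ?_, ?_⟩
  · have := @part1 S (mir (inferInstance : SkewLattice S))
    simp only [meet_assoc, join_assoc]
    exact this
  · have := @part1 S (mir (dul (inferInstance : SkewLattice S)))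
    simp only [meet_assoc, join_assoc]
    exact this
  · exact @part1 S (dul (inferInstance : SkewLattice S))

end SkewLattice
end

section
/- Let S be a skew lattice. Then S satisfies the identity x∨y∨x = (y∧x)∨y∨x (for all x,y ∈ S) if and only if for all x, y ∈ S: if x and y right-meet commute (x∧y = x∧y∧x) then x and y right-join commute (x∨y = y∨x∨y). -/
namespace SkewLattice

variable {S : Type*} [SkewLattice S]

local infixl:70 " ∧' " => SkewLattice.meet
local infixl:65 " ∨' " => SkewLattice.join

@[reducible] def dualJM (S : Type*) [SkewLattice S] : SkewLattice S where
  meet x y := x ∨' y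
  join x y := x ∧' y
  meet_assoc := join_assoc
  join_assoc := meet_assoc
  meet_idem := join_idem
  join_idem := meet_idem
  absorb₁ := absorb₃
  absorb₂ := absorb₄
  absorb₃ := absorb₁
  absorb₄ := absorb₂

@[reducible] def dualOp (S : Type*) [SkewLattice S] : SkewLattice S where
  meet x y := y ∧' x
  join x y := y ∨' x
  meet_assoc x y z := (meet_assoc z y x).symm
  join_assoc x y z := (join_assoc z y x).symm
  meet_idem := meet_idem
  join_idem := join_idem
  absorb₁ := absorb₂
  absorb₂ := absorb₁
  absorb₃ := absorb₄
  absorb₄ := absorb₃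

theorem idem_left (x y : S) : x ∧' (x ∧' y) = x ∧' y := by
  rw [← meet_assoc, meet_idem]

theorem join_sandwich (u b : S) (h : u ∧' (b ∧' u) = u) : b ∨' (u ∨' b) = b := by
  have h1 : u ∨' (b ∧' u) = b ∧' u := by
    have := absorb₄ (b ∧' u) u
    rwa [h] at this
  have h2 : (b ∧' u) ∨' u = u := absorb₄ u b
  have h3 : b ∨' (b ∧' u) = b := absorb₃ b u
  have h4 : b ∨' (u ∨' (b ∧' u)) = b := by rw [h1, h3]
  have h5 : (b ∨' u) ∨' (b ∨' u) = b ∨' u := join_idem _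
  calc b ∨' (u ∨' b) = (b ∨' u) ∨' b := (join_assoc _ _ _).symm
    _ = (b ∨' u) ∨' (b ∨' (u ∨' (b ∧' u))) := by rw [h4]
    _ = ((b ∨' u) ∨' (b ∨' u)) ∨' (b ∧' u) := by simp only [join_assoc]
    _ = b := by rw [h5, join_assoc, h4]

theorem reg_left (a b c : S) (h1 : b ∧' c = b) (h2 : c ∧' b = c) :
    a ∧' (b ∧' (a ∧' c)) = a ∧' b := by
  obtain ⟨u, hu⟩ : ∃ u, u = a ∧' (b ∧' a) := ⟨_, rfl⟩
  obtain ⟨y, hy⟩ : ∃ y, y = u ∨' b := ⟨_, rfl⟩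
  have i1 : a ∧' (b ∧' (a ∧' b)) = a ∧' b := by
    have := meet_idem (a ∧' b)
    rwa [meet_assoc] at this
  have ub : u ∧' b = a ∧' b := by rw [hu, meet_assoc, meet_assoc, i1]
  have hubu : u ∧' (b ∧' u) = u := by
    rw [← meet_assoc, ub, hu, meet_assoc]
    have := meet_idem (a ∧' b)
    calc a ∧' (b ∧' (a ∧' (b ∧' a))) = ((a ∧' b) ∧' (a ∧' b)) ∧' a := by
          simp only [meet_assoc]
      _ = _ := by rw [this, meet_assoc]
  have hby : b ∧' y = y := by
    have := absorb₂ y b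
    rw [hy, join_sandwich u b hubu] at this
    rw [hy]; exact this
  have hyb : y ∧' b = b := by rw [hy]; exact absorb₂ b u
  have huy : u ∧' y = u := by rw [hy]; exact absorb₁ u b
  have hu2 : u = (a ∧' b) ∧' y := by
    rw [← ub, meet_assoc, hby, huy]
  have hcyc : c ∧' (y ∧' c) = c := by
    have e1 : (c ∧' y) ∧' (c ∧' y) = c ∧' y := meet_idem _
    calc c ∧' (y ∧' c) = c ∧' (y ∧' (c ∧' b)) := by rw [h2]
      _ = c ∧' (y ∧' (c ∧' (y ∧' b))) := by rw [hyb]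
      _ = ((c ∧' y) ∧' (c ∧' y)) ∧' b := by simp only [meet_assoc]
      _ = c := by rw [e1, meet_assoc, hyb, h2]
  calc a ∧' (b ∧' (a ∧' c)) = u ∧' c := by rw [hu]; simp only [meet_assoc]
    _ = (a ∧' (b ∧' c)) ∧' (y ∧' c) := by rw [hu2, h1]; simp only [meet_assoc]
    _ = a ∧' (b ∧' (c ∧' (y ∧' c))) := by simp only [meet_assoc]
    _ = a ∧' b := by rw [hcyc, h1]

theorem reg_right (a b c : S) (h1 : c ∧' b = b) (h2 : b ∧' c = c) :
    c ∧' (a ∧' (b ∧' a)) = b ∧' a := by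
  have : ((c ∧' a) ∧' b) ∧' a = b ∧' a := @reg_left S (dualOp S) a b c h1 h2
  simpa only [meet_assoc] using this

theorem key_s5 (x y w : S) (h1 : w ∧' x = x) (h2 : y ∧' w = y) :
    x ∧' (w ∧' (y ∧' x)) = x ∧' (y ∧' x) := by
  have a1 : x ∧' (y ∧' (x ∧' (w ∧' y))) = x ∧' y := by
    apply reg_left
    · rw [← meet_assoc, h2, meet_idem]
    · rw [meet_assoc, meet_idem]
  have a2 : x ∧' ((y ∧' x) ∧' ((x ∧' w) ∧' (y ∧' x))) = (x ∧' w) ∧' (y ∧' x) := by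
    apply reg_right
    · rw [idem_left]
    · rw [meet_assoc, h1, meet_idem]
  have a3 := congrArg (· ∧' x) a1
  simp only [meet_assoc, idem_left] at a2 a3
  rw [← a2, a3]

theorem key_join (x y w : S) (h1 : w ∨' x = x) (h2 : y ∨' w = y) :
    x ∨' (w ∨' (y ∨' x)) = x ∨' (y ∨' x) :=
  @key_s5 S (dualJM S) x y w h1 h2

theorem meet_comm_aux (x y : S) :
    ((y ∧' x) ∨' y) ∧' x = ((y ∧' x) ∨' y) ∧' x ∧' ((y ∧' x) ∨' y) := by
  obtain ⟨w, hw⟩ : ∃ w, w = y ∧' x := ⟨_, rfl⟩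
  rw [← hw]
  obtain ⟨u, hu⟩ : ∃ u, u = w ∨' y := ⟨_, rfl⟩
  rw [← hu]
  have wu : w ∧' u = w := by rw [hu]; exact absorb₁ w y
  have yu : y ∧' u = u := by
    have e : y ∨' u = y := by
      rw [hu, ← join_assoc, hw, absorb₃, join_idem]
    have := absorb₂ u y
    rwa [e] at this
  have wx : w ∧' x = w := by rw [hw, meet_assoc, meet_idem]
  obtain ⟨e, he⟩ : ∃ e, e = u ∧' x := ⟨_, rfl⟩
  rw [← he]
  have ye : y ∧' e = e := by rw [he, ← meet_assoc, yu]
  have ex : e ∧' x = e := by rw [he, meet_assoc, meet_idem]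
  have we : w ∧' e = w := by rw [he, ← meet_assoc, wu, wx]
  have ewe : e ∧' (w ∧' e) = e := by
    have i : (x ∧' y) ∧' (x ∧' y) = x ∧' y := meet_idem _
    calc e ∧' (w ∧' e) = (e ∧' x) ∧' ((y ∧' x) ∧' (y ∧' e)) := by rw [ex, ye, hw]
      _ = e ∧' (((x ∧' y) ∧' (x ∧' y)) ∧' e) := by simp only [meet_assoc]
      _ = (e ∧' x) ∧' (y ∧' e) := by rw [i]; simp only [meet_assoc]
      _ = e := by rw [ex, ye, meet_idem]
  have ew : e ∧' w = e := by rwa [we] at ewe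
  calc e = e ∧' w := ew.symm
    _ = (e ∧' w) ∧' u := by rw [meet_assoc, wu]
    _ = e ∧' u := by rw [ew]

/-- right upper symmetry iff right-meet commuting implies
right-join commuting. -/
theorem right_upper_symmetric_iff_commute :
    (∀ x y : S, x ∨' y ∨' x = (y ∧' x) ∨' y ∨' x) ↔
    (∀ x y : S, x ∧' y = x ∧' y ∧' x → x ∨' y = y ∨' x ∨' y) := by
  constructor
  · intro H x y h
    have e : (x ∧' y) ∨' x = x := by rw [h]; exact absorb₄ x (x ∧' y)
    rw [H y x, e]
  · intro H x y
    have h := H _ _ (meet_comm_aux x y)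
    rw [h]
    have k := key_join x y (y ∧' x) (absorb₄ x y) (absorb₃ y x)
    simp only [join_assoc] at k ⊢
    exact k.symm

end SkewLattice
end

section
/- Let S be a skew lattice with D-classes A > B, and let a ∈ A, b ∈ B. Then b∨A = {u ∈ A : b ≤_L u} and B∧a = {v ∈ B : v ≤_L a}. -/
namespace SkewLattice

variable {S : Type*} [SkewLattice S]

local infixl:70 " ∧' " => SkewLattice.meet
local infixl:65 " ∨' " => SkewLattice.join

theorem aux_band {T : Type*} (f : T → T → T) (as : ∀ x y z, f (f x y) z = f x (f y z))
    (id : ∀ x, f x x = x) (p z q s : T) (hs : s = f (f p z) q) : f (f s z) s = s := by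
  have h1 : f (f p z) s = s := by rw [hs, ← as, id]
  calc f (f s z) s = f (f (f (f p z) s) z) s := by rw [h1]
    _ = f p (f (f z s) (f z s)) := by simp only [as]
    _ = f (f p z) s := by rw [id, as]
    _ = s := h1

theorem aux_trans {x y z : S} (h1 : preceq x y) (h2 : preceq y z) : preceq x z := by
  unfold preceq at *
  apply aux_band _ meet_assoc meet_idem (x ∧' y) z (y ∧' x)
  calc x = x ∧' (y ∧' z ∧' y) ∧' x := by rw [h2, h1]
    _ = _ := by simp only [meet_assoc]

theorem aux_relD {x y z : S} (h1 : relD x y) (h2 : relD y z) : relD x z :=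
  ⟨aux_trans h1.1 h2.1, aux_trans h2.2 h1.2⟩

theorem aux_join {b u : S} (h : preceq b u) : u ∨' b ∨' u = u := by
  unfold preceq at h
  have h1 : (b ∧' u) ∨' b = b ∧' u := by
    have := absorb₃ (b ∧' u) b
    rwa [h] at this
  have h2 : (b ∧' u) ∨' (u ∧' (b ∧' u)) = u ∧' (b ∧' u) := by
    have := absorb₄ (u ∧' (b ∧' u)) (b ∧' u)
    have e : (b ∧' u) ∧' (u ∧' (b ∧' u)) = b ∧' u := by
      rw [← meet_assoc, meet_assoc b u u, meet_idem, meet_idem]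
    rwa [e] at this
  apply aux_band _ join_assoc join_idem (u ∨' (b ∧' u)) b (u ∧' (b ∧' u))
  rw [join_assoc u, h1, join_assoc, h2, absorb₃]

theorem aux_joinD {b u : S} (h : preceq b u) : relD (b ∨' u) u := by
  have h1 := aux_join h
  have h2 : u ∧' (b ∨' u) = b ∨' u := by
    have := absorb₂ (b ∨' u) u
    rwa [← join_assoc, h1] at this
  exact ⟨by rw [absorb₂, h2], by rw [h2, absorb₂]⟩

theorem aux_meetD {v a : S} (h : preceq v a) : relD (v ∧' a) v := by
  unfold preceq at h
  exact ⟨by rw [h, ← meet_assoc, meet_idem], by rw [← meet_assoc, meet_idem, h]⟩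

/-- right image sets described via the flat preorder `≤_L`. -/
theorem rightImage_eq (A B : Set S) (hAB : classGT A B)
    (a : S) (ha : a ∈ A) (b : S) (hb : b ∈ B) :
    {z : S | ∃ u ∈ A, z = b ∨' u} = {u ∈ A | leqL b u} ∧
    {z : S | ∃ v ∈ B, z = v ∧' a} = {v ∈ B | leqL v a} := by
  obtain ⟨⟨a0, rfl⟩, ⟨b0, rfl⟩, H⟩ := hAB
  constructor
  · ext z
    constructor
    · rintro ⟨u, hu, rfl⟩
      exact ⟨aux_relD (aux_joinD (H u hu b hb).1) hu, absorb₁ b u⟩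
    · rintro ⟨hz, hl⟩
      refine ⟨z, hz, ?_⟩
      have := absorb₄ z b
      unfold leqL at hl
      rw [hl] at this
      exact this.symm
  · ext z
    constructor
    · rintro ⟨v, hv, rfl⟩
      refine ⟨aux_relD (aux_meetD (H a ha v hv).1) hv, ?_⟩
      unfold leqL
      rw [meet_assoc, meet_idem]
    · rintro ⟨hz, hl⟩
      exact ⟨z, hz, hl.symm⟩

end SkewLattice
end

section
/- Let S be a skew lattice with D-classes A > B and let a ∈ A. Then for every b ∈ B the intersection (B∧a) ∩ (b∧A) is the singleton {b∧a}; hence the right image set B∧a is a transversal of the family of all right cosets of A in B. -/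
namespace SkewLattice

variable {S : Type*} [SkewLattice S]

local infixl:70 " ∧' " => SkewLattice.meet
local infixl:65 " ∨' " => SkewLattice.join

theorem preceq_trans_aux (x y z : S) (h1 : x ∧' y ∧' x = x) (h2 : y ∧' z ∧' y = y) :
    x ∧' z ∧' x = x := by
  have h3 : x ∧' y ∧' z ∧' y ∧' x = x := by
    have : x ∧' (y ∧' z ∧' y) ∧' x = x := by rw [h2, h1]
    simpa only [meet_assoc] using this
  have h4 : x ∧' z ∧' (y ∧' x) = x := by
    have e : (x ∧' y ∧' z ∧' y ∧' x) ∧' (y ∧' x) = x ∧' y ∧' z ∧' y ∧' x := by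
      have := meet_idem (y ∧' x)
      simp only [meet_assoc] at this ⊢
      rw [this]
    have e2 : x ∧' (y ∧' x) = x := by rw [← meet_assoc, h1]
    have i := meet_idem (z ∧' (y ∧' x))
    have h3' : x ∧' y ∧' (z ∧' (y ∧' x)) = x := by
      simpa only [meet_assoc] using h3
    calc x ∧' z ∧' (y ∧' x) = x ∧' (z ∧' (y ∧' x)) := meet_assoc _ _ _
      _ = x ∧' y ∧' (z ∧' (y ∧' x)) ∧' (z ∧' (y ∧' x)) := by rw [h3']
      _ = x ∧' y ∧' (z ∧' (y ∧' x)) := by rw [meet_assoc (x ∧' y), i]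
      _ = x := h3'
  calc x ∧' z ∧' x = x ∧' z ∧' (x ∧' z ∧' (y ∧' x)) := by rw [h4]
    _ = x ∧' z ∧' (y ∧' x) := by rw [← meet_assoc (x ∧' z) (x ∧' z), meet_idem]
    _ = x := h4

theorem key_aux (a b u : S) (h1 : u ∧' a ∧' u = u) (h2 : a ∧' u ∧' a = a)
    (h : b ∧' u ∧' b = b) : b ∧' u ∧' a = b ∧' a := by
  obtain ⟨e, he⟩ : ∃ e, e = b ∨' u := ⟨_, rfl⟩
  have be : b ∧' e = b := by rw [he, absorb₁]
  have eu : e ∧' u = u := by rw [he, absorb₂]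
  have sb : (b ∧' u) ∨' b = b ∧' u := by
    have := absorb₃ (b ∧' u) b
    rwa [h] at this
  have hu : u = (b ∧' u) ∨' e := by
    rw [he, ← join_assoc, sb, absorb₄]
  have ue : u ∧' e = e := by
    have := absorb₂ e (b ∧' u)
    rwa [← hu] at this
  have h3 : a ∧' e ∧' (u ∧' a) = a := by
    rw [meet_assoc, ← meet_assoc e, eu, ← meet_assoc, h2]
  have aea : a ∧' e ∧' a = a := by
    calc a ∧' e ∧' a = a ∧' e ∧' (a ∧' e ∧' (u ∧' a)) := by rw [h3]
      _ = a := by rw [← meet_assoc (a ∧' e) (a ∧' e), meet_idem, h3]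
  have ea : e ∧' a = u ∧' a := by
    calc e ∧' a = u ∧' a ∧' u ∧' e ∧' a := by rw [h1, ue]
      _ = u ∧' a ∧' e ∧' a := by rw [meet_assoc (u ∧' a) u e, ue]
      _ = u ∧' (a ∧' e ∧' a) := by simp only [meet_assoc]
      _ = u ∧' a := by rw [aea]
  rw [meet_assoc, ← ea, ← meet_assoc, be]

/-- the right image set `B∧a` meets each right coset `b∧A`
in exactly the point `b∧a`. -/
theorem rightImage_transversal (A B : Set S) (hAB : classGT A B)
    (a : S) (ha : a ∈ A) :
    ∀ b ∈ B, {z : S | ∃ v ∈ B, z = v ∧' a} ∩ {z : S | ∃ u ∈ A, z = b ∧' u}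
      = {b ∧' a} := by
  intro b hb
  obtain ⟨⟨c, hc⟩, -, hlt⟩ := hAB
  ext z
  simp only [Set.mem_inter_iff, Set.mem_setOf_eq, Set.mem_singleton_iff]
  constructor
  · rintro ⟨⟨v, -, hv⟩, u, hu, hz⟩
    have hbu : b ∧' u ∧' b = b := (hlt u hu b hb).1
    rw [hc] at ha hu
    obtain ⟨ha1, ha2⟩ := ha
    obtain ⟨hu1, hu2⟩ := hu
    have za : z ∧' a = z := by rw [hv, meet_assoc, meet_idem]
    rw [← za, hz]
    exact key_aux a b u (preceq_trans_aux u c a hu1 ha2) (preceq_trans_aux a c u ha1 hu2) hbu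
  · intro hz
    exact ⟨⟨b, hb, hz⟩, a, ha, hz⟩

end SkewLattice
end

section
/- Let S be a skew lattice with D-classes A > B, and let a ∈ A, b ∈ B. The maps φ : B∨a → b∧A defined by φ(x) = b∧x, and ψ : b∧A → B∨a defined by ψ(y) = y∨a, are mutually inverse bijections. Moreover, for each x ∈ B∨a, b∧x is the unique element y ∈ b∧A with y ≤_L x. -/
namespace SkewLattice

variable {S : Type*} [SkewLattice S]

local infixl:70 " ∧' " => SkewLattice.meet
local infixl:65 " ∨' " => SkewLattice.join

theorem band_core {T : Type*} (f : T → T → T) (as : ∀ x y z, f (f x y) z = f x (f y z))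
    (id : ∀ x, f x x = x) (e p z q : T) (h : e = f (f p z) q) : f (f e z) e = e := by
  have h1 : e = f (f e z) q := by
    calc e = f p (f z q) := by rw [h, as]
      _ = f p (f (f z q) (f z q)) := by rw [id]
      _ = f (f e z) q := by rw [h]; simp only [as]
  calc f (f e z) e = f (f e z) (f (f e z) q) := by rw [← h1]
    _ = f (f e z) q := by rw [← as, id]
    _ = e := h1.symm

theorem band_trans {T : Type*} (f : T → T → T) (as : ∀ x y z, f (f x y) z = f x (f y z))
    (id : ∀ x, f x x = x) (x y z : T) (h : f (f x y) x = x) (k : f (f y z) y = y) :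
    f (f x z) x = x := by
  apply band_core f as id x (f x y) z (f y x)
  calc x = f (f x y) x := h.symm
    _ = f (f x (f (f y z) y)) x := by rw [k]
    _ = _ := by simp only [as]

theorem band_comm {T : Type*} (f : T → T → T) (as : ∀ x y z, f (f x y) z = f x (f y z))
    (id : ∀ x, f x x = x) (u v : T) : f (f (f u v) (f v u)) (f u v) = f u v := by
  apply band_core f as id (f u v) u (f v u) v
  calc f u v = f (f u v) (f u v) := (id _).symm
    _ = _ := by simp only [as]

theorem band_inf {T : Type*} (f : T → T → T) (as : ∀ x y z, f (f x y) z = f x (f y z))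
    (id : ∀ x, f x x = x) (x y z : T) (h : f (f x y) x = x) (k : f (f x z) x = x) :
    f (f x (f y z)) x = x := by
  have h1 : f (f x (f (f y x) z)) x = x := by
    calc f (f x (f (f y x) z)) x = f (f (f x y) x) (f z x) := by simp only [as]
      _ = x := by rw [h, ← as, k]
  have h2 := band_trans f as id _ _ _ h1 (band_comm f as id (f y x) z)
  have h3 : f (f (f z (f y x)) (f z y)) (f z (f y x)) = f z (f y x) := by
    calc _ = f (f (f z (f y x)) (f z y)) (f (f z y) x) := by rw [as z y x]
      _ = f (f z (f y x)) (f (f (f z y) (f z y)) x) := by simp only [as]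
      _ = f (f (f z y) x) (f (f z y) x) := by rw [id]; simp only [as]
      _ = _ := by rw [id, as]
  exact band_trans f as id _ _ _ (band_trans f as id _ _ _ h2 h3) (band_comm f as id z y)

theorem band_rect {T : Type*} (f : T → T → T) (as : ∀ x y z, f (f x y) z = f x (f y z))
    (id : ∀ x, f x x = x) (x y z : T) (h : f (f x y) x = x) (k : f (f x z) x = x)
    (l : f (f z x) z = z) : f (f x y) z = f x z := by
  calc f (f x y) z = f (f x y) (f (f z x) z) := by rw [l]
    _ = f (f (f x (f y z)) x) z := by simp only [as]
    _ = f x z := by rw [band_inf f as id x y z h k]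

theorem prec_dual (v a : S) (h : v ∧' a ∧' v = v) : a ∨' v ∨' a = a := by
  apply band_core join join_assoc join_idem a a v (a ∧' v)
  have h1 : v ∨' (a ∧' v) = a ∧' v := by
    calc v ∨' (a ∧' v) = (v ∧' (a ∧' v)) ∨' (a ∧' v) := by rw [← meet_assoc, h]
      _ = _ := absorb₄ _ _
  rw [join_assoc, h1, absorb₃]

/-- the right coset bijections `φ(x) = b∧x` and `ψ(y) = y∨a`
between `B∨a` and `b∧A` are mutually inverse, and `b∧x` is the unique
element of `b∧A` below `x` for `≤_L`. -/
theorem rightCoset_bijection (A B : Set S) (hAB : classGT A B)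
    (a : S) (ha : a ∈ A) (b : S) (hb : b ∈ B) :
    (∀ x ∈ {z : S | ∃ v ∈ B, z = v ∨' a},
      (b ∧' x) ∈ {z : S | ∃ u ∈ A, z = b ∧' u}) ∧
    (∀ y ∈ {z : S | ∃ u ∈ A, z = b ∧' u},
      (y ∨' a) ∈ {z : S | ∃ v ∈ B, z = v ∨' a}) ∧
    (∀ x ∈ {z : S | ∃ v ∈ B, z = v ∨' a}, (b ∧' x) ∨' a = x) ∧
    (∀ y ∈ {z : S | ∃ u ∈ A, z = b ∧' u}, b ∧' (y ∨' a) = y) ∧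
    (∀ x ∈ {z : S | ∃ v ∈ B, z = v ∨' a}, ∀ y ∈ {z : S | ∃ u ∈ A, z = b ∧' u},
      (leqL y x ↔ y = b ∧' x)) := by
  obtain ⟨⟨a0, hA⟩, ⟨b0, hB⟩, hlt⟩ := hAB
  have tr : ∀ x y z : S, x ∧' y ∧' x = x → y ∧' z ∧' y = y → x ∧' z ∧' x = x :=
    band_trans meet meet_assoc meet_idem
  have pA : ∀ x ∈ A, ∀ y ∈ A, x ∧' y ∧' x = x := by
    intro x hx y hy
    rw [hA] at hx hy
    exact tr _ _ _ hx.1 hy.2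
  have pB : ∀ x ∈ B, ∀ y ∈ B, x ∧' y ∧' x = x := by
    intro x hx y hy
    rw [hB] at hx hy
    exact tr _ _ _ hx.1 hy.2
  have mA : ∀ x ∈ A, ∀ y, x ∧' y ∧' x = x → y ∧' x ∧' y = y → y ∈ A := by
    intro x hx y h k
    rw [hA] at hx ⊢
    exact ⟨tr _ _ _ k hx.1, tr _ _ _ hx.2 h⟩
  have mB : ∀ x ∈ B, ∀ y, x ∧' y ∧' x = x → y ∧' x ∧' y = y → y ∈ B := by
    intro x hx y h k
    rw [hB] at hx ⊢
    exact ⟨tr _ _ _ k hx.1, tr _ _ _ hx.2 h⟩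
  have rA : ∀ x ∈ A, ∀ y ∈ A, ∀ z ∈ A, x ∧' y ∧' z = x ∧' z := fun x hx y hy z hz =>
    band_rect meet meet_assoc meet_idem x y z (pA x hx y hy) (pA x hx z hz) (pA z hz x hx)
  have rB : ∀ x ∈ B, ∀ y ∈ B, ∀ z ∈ B, x ∨' y ∨' z = x ∨' z := fun x hx y hy z hz =>
    band_rect join join_assoc join_idem x y z (prec_dual _ _ (pB y hy x hx))
      (prec_dual _ _ (pB z hz x hx)) (prec_dual _ _ (pB x hx z hz))
  let _ : SkewLattice Sᵒᵈ :=
    { meet := fun x y => (join (x : S) (y : S) : S), join := fun x y => (meet (x : S) (y : S) : S)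
      meet_assoc := join_assoc (S := S), join_assoc := meet_assoc (S := S)
      meet_idem := join_idem (S := S), join_idem := meet_idem (S := S)
      absorb₁ := absorb₃ (S := S), absorb₂ := absorb₄ (S := S)
      absorb₃ := absorb₁ (S := S), absorb₄ := absorb₂ (S := S) }
  have pd : ∀ x y : S, y ∨' x ∨' y = y → x ∧' y ∧' x = x := fun x y h =>
    prec_dual (S := Sᵒᵈ) y x h
  have jA : ∀ v ∈ B, v ∨' a ∈ A := by
    intro v hv
    apply mA a ha
    · rw [meet_assoc, absorb₂, meet_idem]
    · apply pd
      rw [← join_assoc, join_assoc, join_idem]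
      exact prec_dual _ _ (hlt a ha v hv).1
  have jB : ∀ u ∈ A, b ∧' u ∈ B := by
    intro u hu
    apply mB b hb
    · rw [← meet_assoc, meet_idem]
      exact (hlt u hu b hb).1
    · rw [meet_assoc, ← meet_assoc b b u, meet_idem, meet_idem]
  have cA : ∀ u ∈ A, ∀ x ∈ A, b ∧' u ∧' x = b ∧' x := by
    intro u hu x hx
    have hs := jA b hb
    calc b ∧' u ∧' x = b ∧' (b ∨' a) ∧' u ∧' x := by rw [absorb₁]
      _ = b ∧' ((b ∨' a) ∧' u ∧' x) := by simp only [meet_assoc]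
      _ = b ∧' x := by rw [rA _ hs u hu x hx, ← meet_assoc, absorb₁]
  have cB : ∀ y ∈ B, ∀ v ∈ B, y ∨' v ∨' a = y ∨' a := by
    intro y hy v hv
    have hs := jB a ha
    calc y ∨' v ∨' a = y ∨' v ∨' ((b ∧' a) ∨' a) := by rw [absorb₄]
      _ = y ∨' v ∨' (b ∧' a) ∨' a := by simp only [join_assoc]
      _ = y ∨' a := by rw [rB y hy v hv _ hs, join_assoc, absorb₄]
  refine ⟨?_, ?_, ?_, ?_, ?_⟩
  · rintro x ⟨v, hv, rfl⟩
    exact ⟨_, jA v hv, rfl⟩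
  · rintro y ⟨u, hu, rfl⟩
    exact ⟨_, jB u hu, rfl⟩
  · rintro x ⟨v, hv, rfl⟩
    rw [← cB _ (jB _ (jA v hv)) v hv, join_assoc, absorb₄]
  · rintro y ⟨u, hu, rfl⟩
    rw [← cA u hu _ (jA _ (jB u hu)), absorb₁]
  · rintro x ⟨v, hv, rfl⟩ y ⟨u, hu, rfl⟩
    unfold leqL
    rw [cA u hu _ (jA v hv)]
    exact eq_comm

end SkewLattice
end

section
/- Let S be a skew lattice with D-classes A > B and let y, y' ∈ B. The following are equivalent: (i) y∧A = y'∧A; (ii) y∧x = y'∧x for all x ∈ A; (iii) y∧x = y'∧x for some x ∈ A. -/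
namespace SkewLattice

variable {S : Type*} [SkewLattice S]

local infixl:70 " ∧' " => SkewLattice.meet
local infixl:65 " ∨' " => SkewLattice.join

theorem aux_band_s10 (p x x' q : S) (h : p ∧' x' ∧' q = x) : x ∧' x' ∧' x = x := by
  have h1 : x ∧' (x' ∧' q) = x := by
    rw [← h]
    simp only [meet_assoc]
    rw [← meet_assoc x' q, meet_idem]
  have h2 : (x ∧' x') ∧' q = x := by rw [meet_assoc, h1]
  calc x ∧' x' ∧' x = x ∧' x' ∧' ((x ∧' x') ∧' q) := by rw [h2]
    _ = x := by rw [← meet_assoc, meet_idem, h2]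

theorem aux_D (x x' a : S) (h : relD x a) (h' : relD x' a) : x ∧' x' ∧' x = x := by
  apply aux_band_s10 (x ∧' a) x x' (a ∧' x)
  have e : (x ∧' a) ∧' x' ∧' (a ∧' x) = x ∧' (a ∧' x' ∧' a) ∧' x := by
    simp only [meet_assoc]
  rw [e, h'.2, h.1]

theorem aux_key (x w y : S) (h1 : w ∧' x = w) (h2 : x ∧' w = x) (hy : x ∧' y = y) :
    y ∧' w = y ∧' x := by
  have hz1 : y ∧' (y ∨' x) = y := absorb₁ y x
  have hxy : x ∨' y = x := by
    have := absorb₃ x y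
    rwa [hy] at this
  have hz2 : x ∨' (y ∨' x) = x := by rw [← join_assoc, hxy, join_idem]
  have hz3 : x ∧' (y ∨' x) = y ∨' x := by
    have := absorb₂ (y ∨' x) x
    rwa [hz2] at this
  have hz4 : (y ∨' x) ∧' x = x := absorb₂ x y
  generalize y ∨' x = z at *
  have hw : w ∧' z ∧' w = w := by
    apply aux_band_s10 w w z x
    rw [meet_assoc, hz4, h1]
  have hzw : z ∧' w = x := by
    calc z ∧' w = x ∧' w ∧' z ∧' w := by rw [h2, hz3]
      _ = x ∧' (w ∧' z ∧' w) := by simp only [meet_assoc]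
      _ = x := by rw [hw, h2]
  rw [← hzw, ← meet_assoc, hz1]

theorem aux_main (x x' y : S) (h : x ∧' x' ∧' x = x) (h' : x' ∧' x ∧' x' = x')
    (hy : y ∧' x' ∧' y = y) : y ∧' x ∧' x' = y ∧' x' := by
  have k := aux_key x' (x ∧' x') (x' ∧' y) (by rw [meet_assoc, meet_idem])
    (by rw [← meet_assoc, h']) (by rw [← meet_assoc, meet_idem])
  calc y ∧' x ∧' x' = (y ∧' x' ∧' y) ∧' x ∧' x' := by rw [hy]
    _ = y ∧' ((x' ∧' y) ∧' (x ∧' x')) := by simp only [meet_assoc]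
    _ = (y ∧' x' ∧' y) ∧' x' := by rw [k]; simp only [meet_assoc]
    _ = y ∧' x' := by rw [hy]

/-- equal right cosets iff equal action on all of `A`
iff equal action on some element of `A`. -/
theorem rightCoset_eq_tfae (A B : Set S) (hAB : classGT A B)
    (y y' : S) (hy : y ∈ B) (hy' : y' ∈ B) :
    List.TFAE [
      {z : S | ∃ u ∈ A, z = y ∧' u} = {z : S | ∃ u ∈ A, z = y' ∧' u},
      ∀ x ∈ A, y ∧' x = y' ∧' x,
      ∃ x ∈ A, y ∧' x = y' ∧' x ] := by
  obtain ⟨⟨a, rfl⟩, -, hlt⟩ := hAB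
  have key : ∀ b ∈ B, ∀ x, relD x a → ∀ x', relD x' a → b ∧' x ∧' x' = b ∧' x' :=
    fun b hb x hx x' hx' => aux_main x x' b (aux_D x x' a hx hx') (aux_D x' x a hx' hx)
      (hlt x' hx' b hb).1
  tfae_have 1 → 2 := by
    intro h x hx
    have hm : y ∧' x ∈ {z : S | ∃ u ∈ {x | relD x a}, z = y' ∧' u} := by
      rw [← h]; exact ⟨x, hx, rfl⟩
    obtain ⟨u, hu, e⟩ := hm
    rw [← key y' hy' u hu x hx, ← e, meet_assoc, meet_idem]
  tfae_have 2 → 3 := by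
    intro h
    have ha : relD a a := by constructor <;> simp only [meet_idem]
    exact ⟨a, ha, h a ha⟩
  tfae_have 3 → 2 := by
    rintro ⟨x, hx, e⟩ x' hx'
    rw [← key y hy x hx x' hx', e, key y' hy' x hx x' hx']
  tfae_have 2 → 1 := by
    intro h
    ext z
    constructor
    · rintro ⟨u, hu, rfl⟩
      exact ⟨u, hu, h u hu⟩
    · rintro ⟨u, hu, rfl⟩
      exact ⟨u, hu, (h u hu).symm⟩
  tfae_finish

end SkewLattice
end

section
/- Let S be a skew lattice with D-classes A > B and let x ∈ B. The map δ : A∧x∧A → (A∧x) × (x∧A) defined by δ(z) = (z∧x, x∧z) is a bijection, and for all z, z' ∈ A∧x∧A it satisfies δ(z∧z') = (z∧x, x∧z'); hence δ is an isomorphism of the coset A∧x∧A onto the rectangular skew lattice (A∧x) × (x∧A) with operations (p,q)∧(p',q') = (p,q') and (p,q)∨(p',q') = (p',q). -/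
namespace SkewLattice

variable {S : Type*} [SkewLattice S]

local infixl:70 " ∧' " => SkewLattice.meet
local infixl:65 " ∨' " => SkewLattice.join

theorem aux_reg (a y z : S) (hy : a ∧' y = y) (hz : z ∧' a = z) :
    y ∧' (a ∧' z) = y ∧' z := by
  have h1 : a ∨' y = a := by have := absorb₃ a y; rwa [hy] at this
  have h2 : z ∨' a = a := by have := absorb₄ a z; rwa [hz] at this
  obtain ⟨r, hr⟩ : ∃ r, r = y ∨' (a ∨' z) := ⟨_, rfl⟩
  have hyr : y ∧' r = y := by rw [hr]; exact absorb₁ _ _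
  have hrz : r ∧' z = z := by rw [hr, ← join_assoc]; exact absorb₂ _ _
  have har : a ∨' (r ∨' a) = a := by
    rw [hr, join_assoc, join_assoc, h2, join_idem, ← join_assoc, h1, join_idem]
  have hk : a ∧' (r ∨' a) = r ∨' a := by
    have := absorb₂ (r ∨' a) a
    rwa [har] at this
  have hrk : r ∧' (a ∧' (r ∨' a)) = r := by rw [hk]; exact absorb₁ _ _
  have hrar : r ∧' (a ∧' r) = r := by
    calc r ∧' (a ∧' r) = r ∧' (a ∧' (r ∧' (a ∧' (r ∨' a)))) := by rw [hrk]
      _ = ((r ∧' a) ∧' (r ∧' a)) ∧' (r ∨' a) := by simp only [meet_assoc]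
      _ = r := by rw [meet_idem, meet_assoc, hrk]
  calc y ∧' (a ∧' z) = (y ∧' r) ∧' (a ∧' (r ∧' z)) := by rw [hyr, hrz]
    _ = y ∧' ((r ∧' (a ∧' r)) ∧' z) := by simp only [meet_assoc]
    _ = y ∧' z := by rw [hrar, hrz]

/-- Regularity of the meet band. -/
theorem aux_regular (a b c : S) :
    a ∧' (b ∧' (a ∧' (c ∧' a))) = a ∧' (b ∧' (c ∧' a)) := by
  have := aux_reg a (a ∧' b) (c ∧' a) (by rw [← meet_assoc, meet_idem])
    (by rw [meet_assoc, meet_idem])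
  simpa only [meet_assoc] using this

theorem aux_idem2 (a b : S) : a ∧' (a ∧' b) = a ∧' b := by rw [← meet_assoc, meet_idem]

theorem aux_closed (a w v : S) (hw : relD w a) (hv : relD v a) :
    relD (w ∧' v) a ∧ w ∧' (v ∧' w) = w ∧ v ∧' (w ∧' v) = v := by
  have key : ∀ w v : S, relD w a → relD v a → w ∧' (v ∧' w) = w := by
    intro w v hw hv
    obtain ⟨hw1, hw2⟩ := hw
    obtain ⟨hv1, hv2⟩ := hv
    rw [meet_assoc] at hw1 hw2 hv1 hv2
    have e : w ∧' (a ∧' (v ∧' (a ∧' w))) = w ∧' (v ∧' w) := by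
      calc _ = w ∧' (a ∧' ((v ∧' a) ∧' w)) := by simp only [meet_assoc]
        _ = w ∧' (a ∧' (w ∧' ((v ∧' a) ∧' w))) := (aux_regular w a (v ∧' a)).symm
        _ = (w ∧' (a ∧' w)) ∧' ((v ∧' a) ∧' w) := by simp only [meet_assoc]
        _ = w ∧' (v ∧' (a ∧' w)) := by rw [hw1]; simp only [meet_assoc]
        _ = w ∧' (v ∧' (w ∧' (a ∧' w))) := (aux_regular w v a).symm
        _ = _ := by rw [hw1]
    rw [← e]
    calc _ = w ∧' ((a ∧' (v ∧' a)) ∧' w) := by simp only [meet_assoc]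
      _ = w := by rw [hv2, hw1]
  have h1 := key w v hw hv
  have h2 := key v w hv hw
  refine ⟨?_, h1, h2⟩
  obtain ⟨hw1, hw2⟩ := hw
  obtain ⟨hv1, hv2⟩ := hv
  rw [meet_assoc] at hw1 hw2 hv1 hv2
  constructor
  · calc _ = w ∧' (v ∧' (a ∧' (w ∧' v))) := by simp only [meet_assoc]
      _ = w ∧' (v ∧' (a ∧' (v ∧' (w ∧' v)))) := by rw [aux_regular v a w]
      _ = w ∧' v := by rw [h2, hv1]
  · calc _ = a ∧' (w ∧' (v ∧' a)) := by simp only [meet_assoc]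
      _ = a ∧' (w ∧' (a ∧' (v ∧' a))) := (aux_regular a w v).symm
      _ = a := by rw [hv2, hw2]

/-- the map `δ(z) = (z∧x, x∧z)` is a bijection from the full coset
`A∧x∧A` onto `(A∧x) × (x∧A)` satisfying `δ(z∧z') = (z∧x, x∧z')`, hence an
isomorphism onto the rectangular skew lattice `(A∧x) × (x∧A)`. -/
theorem coset_rectangular_decomposition (A B : Set S) (hAB : classGT A B)
    (x : S) (hx : x ∈ B) :
    (∀ z ∈ {z : S | ∃ w ∈ A, z = w ∧' x ∧' w},
      (z ∧' x) ∈ {z : S | ∃ w ∈ A, z = w ∧' x} ∧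
      (x ∧' z) ∈ {z : S | ∃ w ∈ A, z = x ∧' w}) ∧
    (∀ z ∈ {z : S | ∃ w ∈ A, z = w ∧' x ∧' w},
      ∀ z' ∈ {z : S | ∃ w ∈ A, z = w ∧' x ∧' w},
      z ∧' x = z' ∧' x → x ∧' z = x ∧' z' → z = z') ∧
    (∀ p ∈ {z : S | ∃ w ∈ A, z = w ∧' x}, ∀ q ∈ {z : S | ∃ w ∈ A, z = x ∧' w},
      ∃ z ∈ {z : S | ∃ w ∈ A, z = w ∧' x ∧' w}, z ∧' x = p ∧ x ∧' z = q) ∧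
    (∀ z ∈ {z : S | ∃ w ∈ A, z = w ∧' x ∧' w},
      ∀ z' ∈ {z : S | ∃ w ∈ A, z = w ∧' x ∧' w},
      (z ∧' z') ∈ {z : S | ∃ w ∈ A, z = w ∧' x ∧' w} ∧
      (z ∧' z') ∧' x = z ∧' x ∧ x ∧' (z ∧' z') = x ∧' z') := by
  obtain ⟨⟨a, rfl⟩, -, h⟩ := hAB
  have hp : ∀ w, relD w a → x ∧' (w ∧' x) = x := by
    intro w hw
    have := (h w hw x hx).1
    unfold preceq at this
    rwa [meet_assoc] at this
  have hl : ∀ w, relD w a → (w ∧' x ∧' w) ∧' x = w ∧' x := by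
    intro w hw
    rw [meet_assoc, meet_assoc, hp w hw]
  have hr : ∀ w, relD w a → x ∧' (w ∧' x ∧' w) = x ∧' w := by
    intro w hw
    calc _ = (x ∧' (w ∧' x)) ∧' w := by simp only [meet_assoc]
      _ = _ := by rw [hp w hw]
  have hu : ∀ w v, relD w a → relD v a →
      (w ∧' v) ∧' x = w ∧' x ∧ x ∧' (w ∧' v) = x ∧' v := by
    intro w v hw hv
    obtain ⟨-, h1, h2⟩ := aux_closed a w v hw hv
    constructor
    · calc (w ∧' v) ∧' x = (w ∧' v) ∧' (x ∧' (w ∧' x)) := by rw [hp w hw]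
        _ = (w ∧' (v ∧' (x ∧' w))) ∧' x := by simp only [meet_assoc]
        _ = (w ∧' (v ∧' (w ∧' (x ∧' w)))) ∧' x := by rw [aux_regular w v x]
        _ = ((w ∧' (v ∧' w)) ∧' x) ∧' w ∧' x := by simp only [meet_assoc]
        _ = w ∧' x := by rw [h1]; exact hl w hw
    · calc x ∧' (w ∧' v) = (x ∧' (v ∧' x)) ∧' (w ∧' v) := by rw [hp v hv]
        _ = x ∧' (v ∧' (x ∧' (w ∧' v))) := by simp only [meet_assoc]
        _ = x ∧' (v ∧' (x ∧' (v ∧' (w ∧' v)))) := by rw [aux_regular v x w]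
        _ = x ∧' (v ∧' x ∧' v) := by rw [h2]; simp only [meet_assoc]
        _ = x ∧' v := hr v hv
  have hz : ∀ w v, relD w a → relD v a →
      (w ∧' v) ∧' x ∧' (w ∧' v) = w ∧' (x ∧' v) := by
    intro w v hw hv
    rw [(hu w v hw hv).1, meet_assoc, (hu w v hw hv).2]
  refine ⟨?_, ?_, ?_, ?_⟩
  · rintro z ⟨w, hw, rfl⟩
    exact ⟨⟨w, hw, hl w hw⟩, ⟨w, hw, hr w hw⟩⟩
  · rintro z ⟨w, hw, rfl⟩ z' ⟨v, hv, rfl⟩ e1 e2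
    rw [hl w hw, hl v hv] at e1
    rw [hr w hw, hr v hv] at e2
    rw [e1, meet_assoc, e2, ← meet_assoc]
  · rintro p ⟨w, hw, rfl⟩ q ⟨v, hv, rfl⟩
    have hc := (aux_closed a w v hw hv).1
    exact ⟨_, ⟨w ∧' v, hc, rfl⟩, (hl _ hc).trans (hu w v hw hv).1,
      (hr _ hc).trans (hu w v hw hv).2⟩
  · rintro z ⟨w, hw, rfl⟩ z' ⟨v, hv, rfl⟩
    have hc := (aux_closed a w v hw hv).1
    have e : (w ∧' x ∧' w) ∧' (v ∧' x ∧' v) = (w ∧' v) ∧' x ∧' (w ∧' v) := by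
      rw [hz w v hw hv]
      calc _ = w ∧' ((x ∧' ((w ∧' v) ∧' x)) ∧' v) := by simp only [meet_assoc]
        _ = _ := by rw [hp _ hc]
    refine ⟨⟨w ∧' v, hc, e⟩, ?_, ?_⟩
    · rw [e, hl _ hc, hl w hw, (hu w v hw hv).1]
    · rw [e, hr _ hc, hr v hv, (hu w v hw hv).2]

end SkewLattice
end

section
/- Let S be a skew lattice. Then S is right quasi normal, i.e. satisfies the identity y∧x∧a = y∧a∧x∧a for all a, x, y ∈ S, if and only if for every y ∈ S and all x, x' ∈ y∧S with x L x' one has x = x' (i.e., the L-classes of the subalgebra y∧S are trivial). -/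
namespace SkewLattice

variable {S : Type*} [SkewLattice S]

local infixl:70 " ∧' " => SkewLattice.meet
local infixl:65 " ∨' " => SkewLattice.join

theorem regular_aux (a y x : S) :
    meet (meet a y) (meet a (meet x a)) = meet (meet a y) (meet x a) := by
  obtain ⟨e, he⟩ : ∃ e, e = meet a y := ⟨_, rfl⟩
  obtain ⟨f, hf⟩ : ∃ f, f = meet x a := ⟨_, rfl⟩
  have h1 : join a e = a := by rw [he, absorb₃]
  have h2 : join f a = a := by rw [hf, absorb₄]
  rw [← he, ← hf]
  obtain ⟨c, hc⟩ : ∃ c, c = join e a := ⟨_, rfl⟩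
  obtain ⟨d, hd⟩ : ∃ d, d = join a f := ⟨_, rfl⟩
  have ec : meet e c = e := by rw [hc, absorb₁]
  have df : meet d f = f := by rw [hd, absorb₂]
  have ca : meet c a = a := by rw [hc, absorb₂]
  have ad : meet a d = a := by rw [hd, absorb₁]
  have jac : join a c = a := by rw [hc, ← join_assoc, h1, join_idem]
  have jda : join d a = a := by rw [hd, join_assoc, h2, join_idem]
  have ac : meet a c = c := by
    have := absorb₂ c a
    rwa [jac] at this
  have da : meet d a = d := by
    have := absorb₁ d a
    rwa [jda] at this
  have cd : meet c d = a := by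
    calc meet c d = meet (meet a c) (meet d a) := by rw [ac, da]
      _ = meet (meet (meet a d) c) (meet d (meet c a)) := by rw [ad, ca]
      _ = meet a (meet (meet (meet d c) (meet d c)) a) := by simp only [meet_assoc]
      _ = meet (meet a d) (meet c a) := by rw [meet_idem]; simp only [meet_assoc]
      _ = a := by rw [ad, ca, meet_idem]
  calc meet e (meet a f) = meet e (meet (meet c d) f) := by rw [cd]
    _ = meet (meet e c) (meet d f) := by simp only [meet_assoc]
    _ = meet e f := by rw [ec, df]

/-- right quasi normality iff the `L`-classes of each
subalgebra `y∧S` are trivial. -/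
theorem right_quasi_normal_iff :
    (∀ a x y : S, y ∧' x ∧' a = y ∧' a ∧' x ∧' a) ↔
    (∀ y : S, ∀ x ∈ {z : S | ∃ u : S, z = y ∧' u},
      ∀ x' ∈ {z : S | ∃ u : S, z = y ∧' u}, relL x x' → x = x') := by
  constructor
  · rintro h y x ⟨u, hu⟩ x' ⟨u', hu'⟩ ⟨h1, h2⟩
    have hx : meet y x = x := by rw [hu, ← meet_assoc, meet_idem]
    have hx' : meet y x' = x' := by rw [hu', ← meet_assoc, meet_idem]
    have := h x' x y
    rwa [hx, hx', h1, h2, meet_idem] at this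
  · intro h a x y
    refine h y _ ⟨meet x a, by simp only [meet_assoc]⟩ _
      ⟨meet a (meet x a), by simp only [meet_assoc]⟩ ?_
    have r := regular_aux a y x
    simp only [meet_assoc] at r
    have i1 := meet_idem (meet y (meet x a))
    have i2 := meet_idem (meet y (meet a (meet x a)))
    simp only [meet_assoc] at i1 i2
    constructor
    · simp only [meet_assoc]
      rw [r, i1]
    · simp only [meet_assoc]
      rw [← r, i2]

end SkewLattice
end

section
/- A skew lattice S satisfies the normality identity x∧y∧z∧w = x∧z∧y∧w if and only if it satisfies both the right quasi normality identity y∧x∧a = y∧a∧x∧a and the left quasi normality identity a∧x∧y = a∧x∧a∧y. -/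
namespace SkewLattice

variable {S : Type*} [SkewLattice S]

local infixl:70 " ∧' " => SkewLattice.meet
local infixl:65 " ∨' " => SkewLattice.join

/-- normality is equivalent to the conjunction of right and
left quasi normality. -/
theorem normal_iff_quasi_normal :
    (∀ x y z w : S, x ∧' y ∧' z ∧' w = x ∧' z ∧' y ∧' w) ↔
    ((∀ a x y : S, y ∧' x ∧' a = y ∧' a ∧' x ∧' a) ∧
     (∀ a x y : S, a ∧' x ∧' y = a ∧' x ∧' a ∧' y)) := by
  constructor
  · intro h
    refine ⟨fun a x y => ?_, fun a x y => ?_⟩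
    · rw [h y a x a, meet_assoc (y ∧' x) a a, meet_idem]
    · rw [h a x a y, meet_idem]
  · rintro ⟨hR, hL⟩ x y z w
    have h := hL z y w
    rw [hR z y x]
    simp only [meet_assoc] at h ⊢
    rw [← h]

end SkewLattice
end

section
/- Let S be a skew lattice. Then S is right lower symmetric, i.e. satisfies the identity x∧y∧x = x∧y∧(x∨y), if and only if for every skew diamond {J > A, B > M} in S and all m, m' ∈ M: m∧J = m'∧J holds if and only if both m∧A = m'∧A and m∧B = m'∧B hold. -/
namespace SkewLattice

variable {S : Type*} [SkewLattice S]

local infixl:70 " ∧' " => SkewLattice.meet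
local infixl:65 " ∨' " => SkewLattice.join

section band
variable {T : Type*}

theorem band_fac (f : T → T → T) (ha : ∀ x y z, f (f x y) z = f x (f y z)) (hi : ∀ x, f x x = x)
    (s u z v : T) (h : s = f u (f z v)) : f s (f z s) = s := by
  have h1 : f s (f z v) = s := by
    rw [h, ha, hi]
  calc f s (f z s) = f s (f z (f s (f z v))) := by rw [h1]
    _ = f (f (f s z) (f s z)) v := by simp only [ha]
    _ = s := by rw [hi, ha, h1]

theorem band_inf_s19 (f : T → T → T) (ha : ∀ x y z, f (f x y) z = f x (f y z)) (hi : ∀ x, f x x = x)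
    (s x y : T) (hx : f s (f x s) = s) (hy : f s (f y s) = s) :
    f s (f (f x y) s) = s := by
  obtain ⟨e, he⟩ : ∃ e, e = f s x := ⟨_, rfl⟩
  obtain ⟨g, hg⟩ : ∃ g, g = f y s := ⟨_, rfl⟩
  have es : f e s = s := by rw [he, ha, hx]
  have se : f s e = e := by rw [he, ← ha, hi]
  have sg : f s g = s := by rw [hg, hy]
  have gs : f g s = g := by rw [hg, ha, hi]
  have h1 : f (f g e) s = g := by rw [ha, es, gs]
  have h2 : f (f g e) g = g := by
    calc f (f g e) g = f (f g e) (f (f g e) s) := by rw [h1]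
      _ = g := by rw [← ha, hi, h1]
  have h3 : f e g = s := by
    calc f e g = f (f (f s g) e) g := by rw [sg, se]
      _ = f s (f (f g e) g) := by simp only [ha]
      _ = s := by rw [h2, sg]
  calc f s (f (f x y) s) = f e g := by rw [he, hg]; simp only [ha]
    _ = s := h3
end band

theorem pre_fac (s u z v : S) (h : s = u ∧' (z ∧' v)) : preceq s z := by
  have := band_fac (T := S) meet meet_assoc meet_idem s u z v h
  unfold preceq; rw [meet_assoc]; exact this

theorem pre_inf (s x y : S) (hx : preceq s x) (hy : preceq s y) : preceq s (x ∧' y) := by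
  unfold preceq at *; rw [meet_assoc] at *
  exact band_inf_s19 (T := S) meet meet_assoc meet_idem s x y hx hy

theorem pre_refl (x : S) : preceq x x := by
  unfold preceq; rw [meet_idem, meet_idem]

theorem pre_trans {x y z : S} (h : preceq x y) (h' : preceq y z) : preceq x z := by
  unfold preceq at h h'
  refine pre_fac x (x ∧' y) z (y ∧' x) ?_
  calc x = x ∧' (y ∧' z ∧' y) ∧' x := by rw [h', h]
    _ = _ := by simp only [meet_assoc]

theorem pre_join {x y : S} (h : preceq x y) : y ∨' (x ∨' y) = y := by
  unfold preceq at h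
  have h1 : (x ∧' y) ∨' x = x ∧' y := by
    have := absorb₃ (x ∧' y) x
    rwa [h] at this
  refine band_fac (T := S) join join_assoc join_idem y (x ∧' y) x y ?_
  rw [← join_assoc, h1, absorb₄]

theorem join_pre {x y : S} (h : y ∨' (x ∨' y) = y) : preceq x y := by
  have h1 : x ∧' (x ∨' y) = x := absorb₁ x y
  have h2 : (x ∨' y) ∧' y = y := absorb₂ y x
  have h3 : y ∧' (x ∨' y) = x ∨' y := by
    have := absorb₂ (x ∨' y) y
    rwa [h] at this
  refine pre_fac x x y (x ∨' y) ?_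
  rw [h3, h1]

theorem join_fac (s u z v : S) (h : s = u ∨' (z ∨' v)) : preceq z s :=
  join_pre (band_fac (T := S) join join_assoc join_idem s u z v h)

theorem join_sup {x y s : S} (hx : preceq x s) (hy : preceq y s) : preceq (x ∨' y) s :=
  join_pre (band_inf_s19 (T := S) join join_assoc join_idem s x y (pre_join hx) (pre_join hy))

theorem left_join (x y : S) : preceq x (x ∨' y) :=
  join_fac _ x x y (by rw [← join_assoc, join_idem])
theorem right_join (x y : S) : preceq y (x ∨' y) :=
  join_fac _ x y y (by rw [join_idem])
theorem left_meet (x y : S) : preceq (x ∧' y) x :=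
  pre_fac _ x x y (by rw [← meet_assoc, meet_idem])
theorem right_meet (x y : S) : preceq (x ∧' y) y :=
  pre_fac _ x y y (by rw [meet_idem])

theorem reg0 {z x q : S} (hz : preceq z x) (hxq : x ∧' q = x) (hqx : q ∧' x = q) :
    z ∧' q = z ∧' x := by
  have hxq' : preceq x q := pre_fac x x q q (by rw [meet_idem, hxq])
  have hzq := pre_join (pre_trans hz hxq')
  have zb : z ∧' (z ∨' q) = z := absorb₁ z q
  have qb : q ∧' (z ∨' q) = z ∨' q := by
    have := absorb₂ (z ∨' q) q
    rwa [hzq] at this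
  have bq : (z ∨' q) ∧' q = q := absorb₂ q z
  have hb : preceq x (z ∨' q) := pre_fac x x (z ∨' q) q (by rw [bq, hxq])
  have bx : (z ∨' q) ∧' x = q := by
    calc (z ∨' q) ∧' x = q ∧' x ∧' (z ∨' q) ∧' x := by rw [hqx, qb]
      _ = q ∧' (x ∧' (z ∨' q) ∧' x) := by simp only [meet_assoc]
      _ = q := by rw [hb, hqx]
  rw [← bx, ← meet_assoc, zb]

theorem reg {z x p : S} (hz : preceq z x) (hp : preceq x p) :
    z ∧' p ∧' x = z ∧' x := by
  rw [meet_assoc]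
  apply reg0 hz
  · rw [← meet_assoc]; exact hp
  · rw [meet_assoc, meet_idem]

theorem cos1 {c0 m m' : S} {C : Set S} (hC : C = {x | relD x c0})
    (hm : preceq m c0) (hm' : preceq m' c0)
    (h : {z : S | ∃ j ∈ C, z = m ∧' j} = {z : S | ∃ j ∈ C, z = m' ∧' j}) :
    ∀ c ∈ C, m ∧' c = m' ∧' c := by
  intro c hc
  have : m ∧' c ∈ {z : S | ∃ j ∈ C, z = m' ∧' j} := by rw [← h]; exact ⟨c, hc, rfl⟩
  obtain ⟨j, hj, e⟩ := this
  subst hC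
  have h2 : m' ∧' j ∧' c = m' ∧' c :=
    reg (pre_trans hm' hc.2) (pre_trans hc.1 hj.2)
  rw [← h2, ← e, meet_assoc, meet_idem]

theorem cos2 {c0 m m' c : S} {C : Set S} (hC : C = {x | relD x c0})
    (hm : preceq m c0) (hm' : preceq m' c0) (hc : c ∈ C) (h : m ∧' c = m' ∧' c) :
    {z : S | ∃ j ∈ C, z = m ∧' j} = {z : S | ∃ j ∈ C, z = m' ∧' j} := by
  have key : ∀ k ∈ C, m ∧' k = m' ∧' k := by
    intro k hk
    subst hC
    have h1 : m ∧' c ∧' k = m ∧' k := reg (pre_trans hm hk.2) (pre_trans hk.1 hc.2)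
    have h2 : m' ∧' c ∧' k = m' ∧' k := reg (pre_trans hm' hk.2) (pre_trans hk.1 hc.2)
    rw [← h1, ← h2, h]
  ext z
  constructor
  · rintro ⟨j, hj, rfl⟩; exact ⟨j, hj, key j hj⟩
  · rintro ⟨j, hj, rfl⟩; exact ⟨j, hj, (key j hj).symm⟩

/-- right lower symmetry iff in every skew diamond the right
`J`-cosets of elements of `M` coincide exactly when both their right `A`-cosets
and right `B`-cosets coincide. -/
theorem right_lower_symmetric_iff :
    (∀ x y : S, x ∧' y ∧' x = x ∧' y ∧' (x ∨' y)) ↔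
    (∀ J A B M : Set S, IsSkewDiamond J A B M → ∀ m ∈ M, ∀ m' ∈ M,
      ({z : S | ∃ j ∈ J, z = m ∧' j} = {z : S | ∃ j ∈ J, z = m' ∧' j} ↔
        ({z : S | ∃ a ∈ A, z = m ∧' a} = {z : S | ∃ a ∈ A, z = m' ∧' a} ∧
         {z : S | ∃ b ∈ B, z = m ∧' b} = {z : S | ∃ b ∈ B, z = m' ∧' b}))) := by
  constructor
  · rintro H J A B M ⟨⟨j0, hJ⟩, ⟨a0, hA⟩, ⟨b0, hB⟩, ⟨m0, hM⟩, -, a, haA, b, hbB, hmM, hjJ⟩ m hm m' hm'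
    have hma0 : ∀ n ∈ M, preceq n a0 ∧ preceq n b0 ∧ preceq n j0 := by
      intro n hn
      subst hJ hA hB hM
      have h1 : preceq n (a ∧' b ∧' a) := pre_trans hn.1 hmM.2
      have h2 : preceq n a := pre_trans h1 (right_meet _ _)
      have h3 : preceq n b := pre_trans h1 (pre_trans (left_meet _ _) (right_meet _ _))
      exact ⟨pre_trans h2 haA.1, pre_trans h3 hbB.1,
        pre_trans (pre_trans h2 (right_join _ _)) hjJ.1⟩
    obtain ⟨ma, mb, mj⟩ := hma0 m hm
    obtain ⟨ma', mb', mj'⟩ := hma0 m' hm'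
    have hJmem : ∀ x ∈ A, ∀ y ∈ B, x ∨' y ∈ J := by
      intro x hx y hy
      subst hJ hA hB hM
      have hxa : preceq x a := pre_trans hx.1 haA.2
      have hax : preceq a x := pre_trans haA.1 hx.2
      have hyb : preceq y b := pre_trans hy.1 hbB.2
      have hby : preceq b y := pre_trans hbB.1 hy.2
      refine ⟨pre_trans (join_sup ?_ ?_) hjJ.1, pre_trans hjJ.2 (join_sup (join_sup ?_ ?_) ?_)⟩
      · exact pre_trans hxa (right_join _ _)
      · exact pre_trans hyb (pre_trans (right_join _ _) (left_join _ _))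
      · exact pre_trans hax (left_join _ _)
      · exact pre_trans hby (right_join _ _)
      · exact pre_trans hax (left_join _ _)
    constructor
    · intro h
      have hc := cos1 hJ mj mj' h
      have key := hc _ hjJ
      have e1 : (a ∨' b ∨' a) ∧' a = a := absorb₂ _ _
      have hba := hc _ (hJmem a haA b hbB)
      have e2 : (a ∨' b) ∧' b = b := absorb₂ _ _
      refine ⟨cos2 hA ma ma' haA ?_, cos2 hB mb mb' hbB ?_⟩
      · rw [← e1, ← meet_assoc, key, meet_assoc]
      · rw [← e2, ← meet_assoc, hba, meet_assoc]
    · rintro ⟨h1, h2⟩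
      have c1 := cos1 hA ma ma' h1
      have c2 := cos1 hB mb mb' h2
      obtain ⟨x, hx⟩ : ∃ x, x = m ∨' (a ∨' m) := ⟨_, rfl⟩
      obtain ⟨y, hy⟩ : ∃ y, y = m' ∨' (b ∨' m') := ⟨_, rfl⟩
      have xA : x ∈ A := by
        subst hA
        exact ⟨by rw [hx]; exact join_sup ma (join_sup haA.1 ma),
          pre_trans haA.2 (join_fac _ _ _ _ hx)⟩
      have yB : y ∈ B := by
        subst hB
        exact ⟨by rw [hy]; exact join_sup mb' (join_sup hbB.1 mb'),
          pre_trans hbB.2 (join_fac _ _ _ _ hy)⟩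
      have mx : m ∧' x = m := by rw [hx]; exact absorb₁ _ _
      have my : m' ∧' y = m' := by rw [hy]; exact absorb₁ _ _
      have mx' : m' ∧' x = m := by rw [← c1 x xA, mx]
      have my' : m ∧' y = m' := by rw [c2 y yB, my]
      refine cos2 hJ mj mj' (hJmem x xA y yB) ?_
      have e := congrArg (fun t => m ∧' t) (H x y)
      simp only [← meet_assoc, mx, my', mx'] at e
      rw [← e]
      calc m ∧' (x ∨' y) = m ∧' (x ∧' (x ∨' y)) := by rw [← meet_assoc, mx]
        _ = m := by rw [absorb₁, mx]
  · intro H x y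
    have xp : x ∧' (x ∨' y) = x := absorb₁ _ _
    have py : (x ∨' y) ∧' y = y := absorb₂ _ _
    by_cases hxy : preceq x y
    · have h1 : x ∧' y ∧' (x ∨' y) = x ∧' (x ∨' y) :=
        reg (left_join _ _) (join_sup hxy (pre_refl y))
      rw [h1, xp]; exact hxy
    by_cases hyx : preceq y x
    · have h1 : y ∧' x ∧' (x ∨' y) = y ∧' (x ∨' y) :=
        reg (right_join _ _) (join_sup (pre_refl x) hyx)
      rw [meet_assoc y, xp] at h1
      rw [meet_assoc, meet_assoc, h1]
    have zx : preceq (x ∧' y) x := left_meet _ _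
    have zp : x ∧' y ∧' (x ∨' y) ∧' x = x ∧' y ∧' x := reg zx (left_join _ _)
    have rr : ∀ t : S, relD t t := fun t => ⟨pre_refl t, pre_refl t⟩
    have hjD : relD (x ∨' y) (x ∨' y ∨' x) :=
      ⟨left_join _ _, join_sup (pre_refl _) (left_join _ _)⟩
    have m1 : relD (x ∧' y ∧' (x ∨' y)) (x ∧' y ∧' x) := by
      refine ⟨pre_trans (left_meet _ _) (pre_inf _ _ _ (pre_refl _) zx), ?_⟩
      have h1 : preceq (x ∧' y ∧' x) (x ∧' y) := left_meet _ _
      exact pre_inf _ _ _ h1 (pre_trans h1 (pre_trans zx (left_join _ _)))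
    have hd : IsSkewDiamond {t | relD t (x ∨' y ∨' x)} {t | relD t x} {t | relD t y}
        {t | relD t (x ∧' y ∧' x)} := by
      refine ⟨⟨_, rfl⟩, ⟨_, rfl⟩, ⟨_, rfl⟩, ⟨_, rfl⟩, ?_, x, rr x, y, rr y, rr _, rr _⟩
      intro a ha b hb
      exact ⟨fun h => hxy (pre_trans ha.2 (pre_trans h hb.1)),
        fun h => hyx (pre_trans hb.2 (pre_trans h ha.1))⟩
    have h1x : preceq (x ∧' y ∧' x) x := right_meet _ _
    have h1y : preceq (x ∧' y ∧' x) y := pre_trans (left_meet _ _) (right_meet _ _)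
    have h1j : preceq (x ∧' y ∧' x) (x ∨' y ∨' x) := pre_trans h1x (right_join _ _)
    have hJ := (H _ _ _ _ hd (x ∧' y ∧' x) (rr _) (x ∧' y ∧' (x ∨' y)) m1).2
      ⟨cos2 rfl h1x (pre_trans m1.1 h1x) (rr x) (by rw [zp, meet_assoc _ x x, meet_idem]),
       cos2 rfl h1y (pre_trans m1.1 h1y) (rr y) (by
        rw [meet_assoc _ (x ∨' y) y, py, meet_assoc _ x y, meet_idem, meet_assoc x y y, meet_idem])⟩
    have := cos1 rfl h1j (pre_trans m1.1 h1j) hJ (x ∨' y) hjD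
    rwa [meet_assoc _ x (x ∨' y), xp, meet_assoc _ (x ∨' y) (x ∨' y), meet_idem] at this

end SkewLattice
end
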